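/- Let e≥2, let λ be a partition, s∈ℤ, and let r∈ℤ be such that every integer strictly less than r·e belongs to L_s(λ). For j∈ℤ/eℤ set B^r_j(λ,s)=#{x∈L_s(λ) : x≥r·e and x≡j (mod e)} (a finite number). Then for every i∈ℤ/eℤ: M^{(s)}_i(λ) = B^r_{i−1}(λ,s) − B^r_i(λ,s) if i≠0, and M^{(s)}_0(λ) = B^r_{e−1}(λ,s) − B^r_0(λ,s) + 1. -/

import Mathlib

noncomputable section

/-- A partition: a nonincreasing sequence of nonnegative integers with finitely many
nonzero terms. `parts j` is the `(j+1)`-st part `λ_{j+1}` (0-indexed). -/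
structure Ptn where
  parts : ℕ → ℕ
  antitone' : ∀ ⦃i j : ℕ⦄, i ≤ j → parts j ≤ parts i
  eventually_zero : ∃ N, ∀ n, N ≤ n → parts n = 0

/-- The empty partition. -/
def Ptn.empty : Ptn := ⟨fun _ => 0, fun _ _ _ => le_rfl, ⟨0, fun _ _ => rfl⟩⟩

/-- The abacus `L_s(λ) = {λ_j − j + s : j ∈ ℤ_{>0}}` of a partition with charge `s`. -/
def abacus (s : ℤ) (lam : Ptn) : Set ℤ :=
  {x | ∃ j : ℕ, x = (lam.parts j : ℤ) - ((j : ℤ) + 1) + s}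

/-- The Young diagram of an `l`-partition, with 0-indexed rows and columns:
`(a, b, c) ∈ diag 𝛌` represents the node in row `a+1`, column `b+1` of component `c`. -/
def diag {l : ℕ} (lam : Fin l → Ptn) : Set (ℕ × ℕ × Fin l) :=
  {x | x.2.1 < (lam x.2.2).parts x.1}

/-- The rank of an `l`-partition: the number of nodes of its Young diagram. -/
def rank {l : ℕ} (lam : Fin l → Ptn) : ℕ := (diag lam).ncard

/-- The rank of a partition. -/
def rank₁ (lam : Ptn) : ℕ := rank (fun _ : Fin 1 => lam)

/-- The residue of the node `(a,b,c)` (0-indexed), i.e. `(b+1) − (a+1) + s_c mod e`. -/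
def res (e : ℕ) {l : ℕ} (s : Fin l → ℤ) (x : ℕ × ℕ × Fin l) : ZMod e :=
  (((x.2.1 : ℤ) - (x.1 : ℤ) + s x.2.2 : ℤ) : ZMod e)

/-- `c^{e,s}_i(𝛌)`: the number of nodes of `𝛌` of residue `i`. -/
def resCount (e : ℕ) {l : ℕ} (s : Fin l → ℤ) (lam : Fin l → Ptn) (i : ZMod e) : ℕ :=
  {x ∈ diag lam | res e s x = i}.ncard

/-- `c^{e,(t)}_i(λ)` for a single partition with charge `t`. -/
def resCount₁ (e : ℕ) (t : ℤ) (lam : Ptn) (i : ZMod e) : ℕ :=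
  resCount e (fun _ : Fin 1 => t) (fun _ => lam) i

/-- A node `γ` of `𝛌` is removable if deleting it yields the Young diagram
of an `l`-partition. -/
def Removable {l : ℕ} (lam : Fin l → Ptn) (γ : ℕ × ℕ × Fin l) : Prop :=
  γ ∈ diag lam ∧ ∃ mu : Fin l → Ptn, diag mu = diag lam \ {γ}

/-- A node `γ ∉ [𝛌]` is addable for `𝛌` if adding it yields the Young diagram
of an `l`-partition. -/
def Addable {l : ℕ} (lam : Fin l → Ptn) (γ : ℕ × ℕ × Fin l) : Prop :=
  γ ∉ diag lam ∧ ∃ mu : Fin l → Ptn, diag mu = diag lam ∪ {γ}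

/-- `M^s_i(𝛌)`: the number of addable nodes of residue `i` minus the number of
removable nodes of residue `i`. -/
def Mnum (e : ℕ) {l : ℕ} (s : Fin l → ℤ) (lam : Fin l → Ptn) (i : ZMod e) : ℤ :=
  ({γ | Addable lam γ ∧ res e s γ = i}.ncard : ℤ) -
    ({γ | Removable lam γ ∧ res e s γ = i}.ncard : ℤ)

/-- `M^{(t)}_i(λ)` for a single partition with charge `t`. -/
def Mnum₁ (e : ℕ) (t : ℤ) (lam : Ptn) (i : ZMod e) : ℤ :=
  Mnum e (fun _ : Fin 1 => t) (fun _ => lam) i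

/-- The block `(e,s)`-weight of Fayers:
`p_{(e,s)}(𝛌) = Σ_{i=1}^{l} c_{s_i}(𝛌) − (1/2) Σ_{i ∈ ℤ/eℤ} (c_i(𝛌) − c_{i−1}(𝛌))²`. -/
def blockWeight (e : ℕ) {l : ℕ} (s : Fin l → ℤ) (lam : Fin l → Ptn) : ℚ :=
  (∑ i : Fin l, (resCount e s lam ((s i : ZMod e)) : ℚ)) -
    (1 / 2) * ∑ i ∈ Finset.range e,
      ((resCount e s lam ((i : ZMod e)) : ℚ) - (resCount e s lam ((i : ZMod e) - 1) : ℚ)) ^ 2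

/-- Block weight of a single partition with charge `t`. -/
def blockWeight₁ (e : ℕ) (t : ℤ) (lam : Ptn) : ℚ :=
  blockWeight e (fun _ : Fin 1 => t) (fun _ => lam)

/-- The `l`-abacus `(L_{s_1}(λ^1),…,L_{s_l}(λ^l))` is `(e,s)`-complete:
`L_{s_1}(λ^1) ⊆ … ⊆ L_{s_l}(λ^l) ⊆ {x+e : x ∈ L_{s_1}(λ^1)}`. -/
def Complete (e : ℕ) {l : ℕ} (s : Fin l → ℤ) (lam : Fin l → Ptn) : Prop :=
  (∀ i j : Fin l, (j : ℕ) = (i : ℕ) + 1 →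
      abacus (s i) (lam i) ⊆ abacus (s j) (lam j)) ∧
  (∀ i j : Fin l, (i : ℕ) = l - 1 → (j : ℕ) = 0 →
      abacus (s i) (lam i) ⊆ {x | x - (e : ℤ) ∈ abacus (s j) (lam j)})

/-- `𝒜̄^l_e = {s ∈ ℤ^l : 0 ≤ s_j − s_i ≤ e for all i < j}`. -/
def Abar (e : ℕ) {l : ℕ} (s : Fin l → ℤ) : Prop :=
  ∀ i j : Fin l, i < j → 0 ≤ s j - s i ∧ s j - s i ≤ (e : ℤ)

/-- `𝒜^l_e = {s ∈ ℤ^l : 0 ≤ s_j − s_i < e for all i < j}`. -/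
def Aset (e : ℕ) {l : ℕ} (s : Fin l → ℤ) : Prop :=
  ∀ i j : Fin l, i < j → 0 ≤ s j - s i ∧ s j - s i < (e : ℤ)

/-- A partition is an `e`-core if its abacus is stable under subtracting `e`
(a condition independent of the charge). -/
def IsECore (e : ℕ) (lam : Ptn) : Prop :=
  ∀ x ∈ abacus 0 lam, x - (e : ℤ) ∈ abacus 0 lam

/-- The permutation `σ_s`: the unique permutation sorting the residues
`s'_i = s_i mod e ∈ {0,…,e−1}` increasingly and stably. -/
def sigmaPerm (e : ℕ) {l : ℕ} (s : Fin l → ℤ) : Equiv.Perm (Fin l) :=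
  Tuple.sort (fun i => s i % (e : ℤ))

/-- `𝛌` is an `(e,s)`-core if `𝛌^{σ_s}` is a reduced `(e, s̃^{σ_s})`-core. -/
def IsCore (e : ℕ) {l : ℕ} (s : Fin l → ℤ) (lam : Fin l → Ptn) : Prop :=
  Complete e (fun i => s (sigmaPerm e s i) % (e : ℤ)) (fun i => lam (sigmaPerm e s i))

/-- The set `{(l−c)e + q·e·l + r : 1 ≤ c ≤ l, q ∈ ℤ, 0 ≤ r ≤ e−1, qe+r ∈ L_{s_c}(λ^c)}`
(with `c = (c' : Fin l) + 1`). -/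
def uglovSet (e : ℕ) {l : ℕ} (s : Fin l → ℤ) (lam : Fin l → Ptn) : Set ℤ :=
  {y | ∃ (c : Fin l) (q : ℤ) (r : ℕ), r < e ∧
      (q * (e : ℤ) + (r : ℤ)) ∈ abacus (s c) (lam c) ∧
      y = ((l : ℤ) - 1 - ((c : ℕ) : ℤ)) * (e : ℤ) + q * (e : ℤ) * (l : ℤ) + (r : ℤ)}

/-- `μ = τ_{e,s}(𝛌)`: the Uglov map sends `𝛌` to the unique partition `μ` whose abacus
with charge `t = s_1 + … + s_l` is the Uglov set of `(𝛌,s)`. -/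
def IsUglov (e : ℕ) {l : ℕ} (s : Fin l → ℤ) (lam : Fin l → Ptn) (mu : Ptn) : Prop :=
  abacus (∑ i, s i) mu = uglovSet e s lam

/-- An elementary operation on a pair (`l`-partition, multicharge), performed on the
associated `l`-abacus. -/
def ElemOp (e : ℕ) {l : ℕ} (p q : (Fin l → Ptn) × (Fin l → ℤ)) : Prop :=
  (∃ (i j : Fin l) (x : ℤ), (j : ℕ) = (i : ℕ) + 1 ∧
      x ∈ abacus (p.2 i) (p.1 i) ∧ x ∉ abacus (p.2 j) (p.1 j) ∧
      abacus (q.2 i) (q.1 i) = abacus (p.2 i) (p.1 i) \ {x} ∧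
      abacus (q.2 j) (q.1 j) = abacus (p.2 j) (p.1 j) ∪ {x} ∧
      q.2 i = p.2 i - 1 ∧ q.2 j = p.2 j + 1 ∧
      (∀ k, k ≠ i → k ≠ j → q.1 k = p.1 k ∧ q.2 k = p.2 k)) ∨
  (∃ (i j : Fin l) (x : ℤ), (i : ℕ) = l - 1 ∧ (j : ℕ) = 0 ∧
      x ∈ abacus (p.2 i) (p.1 i) ∧ x - (e : ℤ) ∉ abacus (p.2 j) (p.1 j) ∧
      (i = j → abacus (q.2 i) (q.1 i) = (abacus (p.2 i) (p.1 i) \ {x}) ∪ {x - (e : ℤ)} ∧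
        q.2 i = p.2 i) ∧
      (i ≠ j → abacus (q.2 i) (q.1 i) = abacus (p.2 i) (p.1 i) \ {x} ∧
        abacus (q.2 j) (q.1 j) = abacus (p.2 j) (p.1 j) ∪ {x - (e : ℤ)} ∧
        q.2 i = p.2 i - 1 ∧ q.2 j = p.2 j + 1) ∧
      (∀ k, k ≠ i → k ≠ j → q.1 k = p.1 k ∧ q.2 k = p.2 k))

/-- A sequence of `n` elementary operations starting from `p`. -/
def OpSeq (e : ℕ) {l : ℕ} (p : (Fin l → Ptn) × (Fin l → ℤ))
    (f : ℕ → (Fin l → Ptn) × (Fin l → ℤ)) (n : ℕ) : Prop :=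
  f 0 = p ∧ ∀ k < n, ElemOp e (f k) (f (k + 1))

/-- A maximal sequence of elementary operations: performed until the resulting
`l`-abacus is complete for the current multicharge. -/
def MaxOpSeq (e : ℕ) {l : ℕ} (p : (Fin l → Ptn) × (Fin l → ℤ))
    (f : ℕ → (Fin l → Ptn) × (Fin l → ℤ)) (n : ℕ) : Prop :=
  OpSeq e p f n ∧ Complete e (f n).2 (f n).1

/-- `q` is the core of the pair `p`: it is reached from `p` by a maximal sequence
of elementary operations. -/
def IsCorePairOf (e : ℕ) {l : ℕ} (p q : (Fin l → Ptn) × (Fin l → ℤ)) : Prop :=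
  ∃ f n, MaxOpSeq e p f n ∧ f n = q

/-- `κ = Core_e(λ)`: on abaci, the abacus of `κ` is obtained from that of `λ` by
repeatedly replacing an element `y` with `y − e ∉ L` by `y − e`, until no such
replacement is possible. -/
def IsECoreOf (e : ℕ) (kappa lam : Ptn) : Prop :=
  IsECore e kappa ∧ ∃ (f : ℕ → Ptn) (m : ℕ), f 0 = lam ∧ f m = kappa ∧
    ∀ k < m, ∃ y ∈ abacus 0 (f k), y - (e : ℤ) ∉ abacus 0 (f k) ∧
      abacus 0 (f (k + 1)) = (abacus 0 (f k) \ {y}) ∪ {y - (e : ℤ)}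

end

theorem addable_iff (lam : Ptn) (a b : ℕ) (c : Fin 1) :
    Addable (fun _ : Fin 1 => lam) (a, b, c) ↔
      b = lam.parts a ∧ ∀ a' < a, lam.parts a < lam.parts a' := by
  constructor
  · rintro ⟨hn, mu, hmu⟩
    have hm : ∀ x y : ℕ, y < (mu c).parts x ↔ (y < lam.parts x ∨ (x = a ∧ y = b)) := by
      intro x y
      have := Set.ext_iff.mp hmu (x, y, c)
      simpa [diag, or_comm] using this
    have hn' : lam.parts a ≤ b := by simpa [diag] using hn
    have h1 : b < (mu c).parts a := (hm a b).2 (Or.inr ⟨rfl, rfl⟩)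
    have hb : b = lam.parts a := by
      have := (hm a (lam.parts a)).1 (by omega)
      omega
    refine ⟨hb, fun a' ha' => ?_⟩
    have h2 := (mu c).antitone' ha'.le
    have := (hm a' b).1 (by omega)
    omega
  · rintro ⟨rfl, h⟩
    refine ⟨by simp [diag], fun _ => ⟨Function.update lam.parts a (lam.parts a + 1), ?_, ?_⟩, ?_⟩
    · intro i j hij
      have := lam.antitone' hij
      simp only [Function.update_apply]
      split_ifs with h1 h2 h2
      · omega
      · subst h1
        exact h i (by omega)
      · subst h2
        omega
      · exact this
    · obtain ⟨N, hN⟩ := lam.eventually_zero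
      refine ⟨N + a + 1, fun n hn => ?_⟩
      rw [Function.update_of_ne (by omega)]
      exact hN n (by omega)
    · ext ⟨x, y, z⟩
      have hz : z = c := Subsingleton.elim _ _
      simp only [diag, Set.mem_setOf_eq, Function.update_apply, Set.mem_union,
        Set.mem_singleton_iff, Prod.mk.injEq, hz, and_true]
      split_ifs with hx
      · subst hx
        omega
      · omega

theorem removable_iff (lam : Ptn) (a b : ℕ) (c : Fin 1) :
    Removable (fun _ : Fin 1 => lam) (a, b, c) ↔
      lam.parts a = b + 1 ∧ ∀ a', a < a' → lam.parts a' ≤ b := by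
  constructor
  · rintro ⟨hn, mu, hmu⟩
    have hm : ∀ x y : ℕ, y < (mu c).parts x ↔ (y < lam.parts x ∧ ¬ (x = a ∧ y = b)) := by
      intro x y
      have := Set.ext_iff.mp hmu (x, y, c)
      simpa [diag] using this
    have hn' : b < lam.parts a := by simpa [diag] using hn
    have h1 : ¬ b < (mu c).parts a := fun h => ((hm a b).1 h).2 ⟨rfl, rfl⟩
    have hb : lam.parts a = b + 1 := by
      have := (hm a (b + 1))
      omega
    refine ⟨hb, fun a' ha' => ?_⟩
    have h2 := (mu c).antitone' ha'.le
    have := (hm a' b)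
    omega
  · rintro ⟨hb, h⟩
    refine ⟨by simp [diag, hb], fun _ => ⟨Function.update lam.parts a b, ?_, ?_⟩, ?_⟩
    · intro i j hij
      have := lam.antitone' hij
      simp only [Function.update_apply]
      split_ifs with h1 h2 h2
      · omega
      · subst h1
        omega
      · subst h2
        exact h j (by omega)
      · exact this
    · obtain ⟨N, hN⟩ := lam.eventually_zero
      refine ⟨N + a + 1, fun n hn => ?_⟩
      rw [Function.update_of_ne (by omega)]
      exact hN n (by omega)
    · ext ⟨x, y, z⟩
      have hz : z = c := Subsingleton.elim _ _
      simp only [diag, Set.mem_setOf_eq, Function.update_apply, Set.mem_diff,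
        Set.mem_singleton_iff, Prod.mk.injEq, hz, and_true]
      split_ifs with hx
      · subst hx
        omega
      · omega

theorem addable_ncard (e : ℕ) (lam : Ptn) (s : ℤ) (i : ZMod e) :
    {γ | Addable (fun _ : Fin 1 => lam) γ ∧ res e (fun _ => s) γ = i}.ncard =
      {y : ℤ | y - 1 ∈ abacus s lam ∧ y ∉ abacus s lam ∧ (y : ZMod e) = i}.ncard := by
  rw [← Set.InjOn.ncard_image
    (f := fun γ : ℕ × ℕ × Fin 1 => (γ.2.1 : ℤ) - (γ.1 : ℤ) + s)]
  · congr 1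
    ext y
    simp only [Set.mem_image, Set.mem_setOf_eq, Prod.exists]
    constructor
    · rintro ⟨a, b, c, ⟨h, hres⟩, rfl⟩
      rw [addable_iff] at h
      obtain ⟨rfl, h⟩ := h
      refine ⟨⟨a, by ring⟩, ?_, hres⟩
      rintro ⟨j, hj⟩
      rcases lt_or_ge j a with hja | hja
      · have := h j hja
        omega
      · have := lam.antitone' hja
        omega
    · rintro ⟨⟨a, ha⟩, hy, hi⟩
      have hya : y = (lam.parts a : ℤ) - a + s := by omega
      refine ⟨a, lam.parts a, 0, ⟨(addable_iff _ _ _ _).2 ⟨rfl, fun a' ha' => ?_⟩, ?_⟩, hya.symm⟩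
      · by_contra hcon
        apply hy
        have h1 := lam.antitone' (show a' ≤ a - 1 by omega)
        have h2 := lam.antitone' (show a - 1 ≤ a by omega)
        exact ⟨a - 1, by omega⟩
      · rw [← hi, hya]
        rfl
  · rintro ⟨a, b, c⟩ ⟨h, -⟩ ⟨a', b', c'⟩ ⟨h', -⟩ heq
    rw [addable_iff] at h h'
    obtain ⟨rfl, h⟩ := h
    obtain ⟨rfl, h'⟩ := h'
    have hc : c = c' := Subsingleton.elim _ _
    simp only at heq
    have haa : a = a' := by
      rcases le_total a a' with hl | hl
      · have := lam.antitone' hl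
        omega
      · have := lam.antitone' hl
        omega
    rw [haa, hc]

theorem removable_ncard (e : ℕ) (lam : Ptn) (s : ℤ) (i : ZMod e) :
    {γ | Removable (fun _ : Fin 1 => lam) γ ∧ res e (fun _ => s) γ = i}.ncard =
      {y : ℤ | y ∈ abacus s lam ∧ y - 1 ∉ abacus s lam ∧ (y : ZMod e) = i}.ncard := by
  rw [← Set.InjOn.ncard_image
    (f := fun γ : ℕ × ℕ × Fin 1 => (γ.2.1 : ℤ) - (γ.1 : ℤ) + s)]
  · congr 1
    ext y
    simp only [Set.mem_image, Set.mem_setOf_eq, Prod.exists]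
    constructor
    · rintro ⟨a, b, c, ⟨h, hres⟩, rfl⟩
      rw [removable_iff] at h
      obtain ⟨hb, h⟩ := h
      refine ⟨⟨a, by omega⟩, ?_, hres⟩
      rintro ⟨j, hj⟩
      rcases lt_or_ge a j with hja | hja
      · have := h j hja
        omega
      · have := lam.antitone' hja
        omega
    · rintro ⟨⟨a, ha⟩, hy, hi⟩
      have hlt : lam.parts (a + 1) < lam.parts a := by
        by_contra hcon
        apply hy
        have h2 := lam.antitone' (show a ≤ a + 1 by omega)
        exact ⟨a + 1, by push_cast; omega⟩
      have hya : y = ((lam.parts a - 1 : ℕ) : ℤ) - a + s := by omega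
      refine ⟨a, lam.parts a - 1, 0,
        ⟨(removable_iff _ _ _ _).2 ⟨by omega, fun a' ha' => ?_⟩, ?_⟩, hya.symm⟩
      · have h1 := lam.antitone' (show a + 1 ≤ a' by omega)
        omega
      · rw [← hi, hya]
        rfl
  · rintro ⟨a, b, c⟩ ⟨h, -⟩ ⟨a', b', c'⟩ ⟨h', -⟩ heq
    rw [removable_iff] at h h'
    obtain ⟨hb, h⟩ := h
    obtain ⟨hb', h'⟩ := h'
    have hc : c = c' := Subsingleton.elim _ _
    simp only at heq
    have haa : a = a' := by
      rcases le_total a a' with hl | hl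
      · have := lam.antitone' hl
        omega
      · have := lam.antitone' hl
        omega
    have hbb : b = b' := by
      subst haa
      omega
    rw [haa, hc, hbb]

theorem abacus_fin (s : ℤ) (lam : Ptn) (m : ℤ) : {x ∈ abacus s lam | m ≤ x}.Finite := by
  apply (Set.finite_Icc m ((lam.parts 0 : ℤ) + s)).subset
  rintro x ⟨⟨j, hj⟩, hx⟩
  have := lam.antitone' (Nat.zero_le j)
  exact ⟨hx, by omega⟩

theorem Mnum_eq (e : ℕ) (lam : Ptn) (s : ℤ) (m : ℤ)
    (hr : ∀ x : ℤ, x < m → x ∈ abacus s lam) (i : ZMod e) :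
    Mnum₁ e s lam i =
      ({x ∈ abacus s lam | m - 1 ≤ x ∧ (x : ZMod e) = i - 1}.ncard : ℤ) -
      ({x ∈ abacus s lam | m ≤ x ∧ (x : ZMod e) = i}.ncard : ℤ) := by
  unfold Mnum₁ Mnum
  rw [addable_ncard, removable_ncard]
  set R := {x ∈ abacus s lam | m - 1 ≤ x ∧ (x : ZMod e) = i - 1} with hR
  set Q := {x ∈ abacus s lam | m ≤ x ∧ (x : ZMod e) = i} with hQ
  have hRf : R.Finite := (abacus_fin s lam (m - 1)).subset fun x hx => ⟨hx.1, hx.2.1⟩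
  have hQf : Q.Finite := (abacus_fin s lam m).subset fun x hx => ⟨hx.1, hx.2.1⟩
  have hcast : ∀ y : ℤ, ((y - 1 : ℤ) : ZMod e) = i - 1 ↔ (y : ZMod e) = i := by
    intro y
    push_cast
    exact sub_left_inj
  set P : Set ℤ := (fun x => x + 1) '' R with hP
  have hmem : ∀ y, y ∈ P ↔ (y - 1 ∈ abacus s lam ∧ m ≤ y ∧ (y : ZMod e) = i) := by
    intro y
    rw [hP, hR]
    constructor
    · rintro ⟨x, ⟨h1, h2, h3⟩, rfl⟩
      refine ⟨by simpa using h1, by simp only; omega, ?_⟩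
      rw [← hcast]
      simpa using h3
    · rintro ⟨h1, h2, h3⟩
      exact ⟨y - 1, ⟨h1, by omega, (hcast y).2 h3⟩, by simp⟩
  have hPc : P.ncard = R.ncard := Set.ncard_image_of_injective _ (add_left_injective 1)
  have hPf : P.Finite := hRf.image _
  have e1 : {y : ℤ | y - 1 ∈ abacus s lam ∧ y ∉ abacus s lam ∧ (y : ZMod e) = i} = P \ Q := by
    ext y
    rw [Set.mem_diff, hmem]
    have := hr y
    by_cases hy : m ≤ y
    · simp only [hQ, Set.mem_setOf_eq]
      tauto
    · have := this (by omega)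
      simp only [Set.mem_setOf_eq]
      tauto
  have e2 : {y : ℤ | y ∈ abacus s lam ∧ y - 1 ∉ abacus s lam ∧ (y : ZMod e) = i} = Q \ P := by
    ext y
    rw [Set.mem_diff, hmem]
    have := hr (y - 1)
    by_cases hy : m ≤ y
    · simp only [hQ, Set.mem_setOf_eq]
      tauto
    · have := this (by omega)
      simp only [hQ, Set.mem_setOf_eq]
      tauto
  rw [e1, e2, ← hPc]
  have h1 := Set.ncard_inter_add_ncard_diff_eq_ncard P Q hPf
  have h2 := Set.ncard_inter_add_ncard_diff_eq_ncard Q P hQf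
  rw [Set.inter_comm] at h2
  omega

/-- computation of `M^{(s)}_i(λ)` from bead counts on the abacus. -/
theorem stmt11 (e : ℕ) (he : 2 ≤ e) (lam : Ptn) (s : ℤ) (r : ℤ)
    (hr : ∀ x : ℤ, x < r * (e : ℤ) → x ∈ abacus s lam) (i : ZMod e) :
    (i ≠ 0 → Mnum₁ e s lam i =
        ({x ∈ abacus s lam | r * (e : ℤ) ≤ x ∧ (x : ZMod e) = i - 1}.ncard : ℤ) -
        ({x ∈ abacus s lam | r * (e : ℤ) ≤ x ∧ (x : ZMod e) = i}.ncard : ℤ)) ∧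
      Mnum₁ e s lam 0 =
        ({x ∈ abacus s lam | r * (e : ℤ) ≤ x ∧ (x : ZMod e) = (e : ZMod e) - 1}.ncard : ℤ) -
        ({x ∈ abacus s lam | r * (e : ℤ) ≤ x ∧ (x : ZMod e) = 0}.ncard : ℤ) + 1 := by
  have hm1 : r * (e : ℤ) - 1 ∈ abacus s lam := hr _ (by omega)
  have hc : ((r * (e : ℤ) - 1 : ℤ) : ZMod e) = -1 := by simp
  constructor
  · intro hi
    rw [Mnum_eq e lam s _ hr i]
    congr 3
    ext x
    simp only [Set.mem_setOf_eq]
    refine and_congr_right fun _ => and_congr_left fun h => ⟨fun h1 => ?_, fun h1 => by omega⟩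
    by_contra h2
    have hx : x = r * (e : ℤ) - 1 := by omega
    rw [hx, hc] at h
    apply hi
    linear_combination -h
  · rw [Mnum_eq e lam s _ hr 0]
    have : {x ∈ abacus s lam | r * (e : ℤ) - 1 ≤ x ∧ (x : ZMod e) = 0 - 1} =
        insert (r * (e : ℤ) - 1)
          {x ∈ abacus s lam | r * (e : ℤ) ≤ x ∧ (x : ZMod e) = (e : ZMod e) - 1} := by
      ext x
      simp only [Set.mem_setOf_eq, Set.mem_insert_iff, ZMod.natCast_self]
      constructor
      · rintro ⟨h1, h2, h3⟩
        by_cases hx : x = r * (e : ℤ) - 1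
        · exact Or.inl hx
        · exact Or.inr ⟨h1, by omega, h3⟩
      · rintro (rfl | ⟨h1, h2, h3⟩)
        · exact ⟨hm1, le_rfl, by rw [hc]; simp⟩
        · exact ⟨h1, by omega, h3⟩
    rw [this, Set.ncard_insert_of_notMem (hs := (abacus_fin s lam (r * (e : ℤ))).subset
      fun x hx => ⟨hx.1, hx.2.1⟩)]
    · push_cast
      ring
    · rintro ⟨-, h, -⟩
      omega
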